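/- Let p be an odd prime, f ∈ ℤ_p[X] a polynomial of degree q ≥ 1, and x₀ ∈ ℤ with f(x₀) ≡ 0 (mod p) and f'(x₀) ≢ 0 (mod p). Let (x_n) be the Olver sequence and let ξ ∈ ℤ_p be its limit, which is a zero of f with ξ ≡ x₀ (mod p). Then for every n ∈ ℕ, |x_n − ξ|_p ≤ p^{−3^n}; that is, the Olver iterates converge to ξ at least at cubic rate. -/

import Mathlib

open Polynomial Filter

/-- The Olver iteration sequence in `ℚ_[p]` for a polynomial `f ∈ ℤ_p[X]`,
starting from an integer `x₀`:
`x_{n+1} = x_n − f(x_n)/f'(x_n) − (1/2)·f(x_n)²·f''(x_n)/f'(x_n)³`. -/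
noncomputable def olverSeq {p : ℕ} [Fact p.Prime] (f : Polynomial ℤ_[p]) (x₀ : ℤ) :
    ℕ → ℚ_[p]
  | 0 => (x₀ : ℚ_[p])
  | n + 1 =>
      olverSeq f x₀ n
        - aeval (olverSeq f x₀ n) f / aeval (olverSeq f x₀ n) (derivative f)
        - (1 / 2) * ((aeval (olverSeq f x₀ n) f) ^ 2
            * aeval (olverSeq f x₀ n) (derivative (derivative f))
            / (aeval (olverSeq f x₀ n) (derivative f)) ^ 3)

/-- Third-order Taylor expansion of a polynomial over a commutative ring, in which the
second-order coefficient `c` satisfies `2 * c = f''(x)`. -/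
theorem Polynomial.exists_eval_add_eq_cubic {R : Type*} [CommRing R] (f : Polynomial R) (x h : R) :
    ∃ c d : R, 2 * c = (derivative (derivative f)).eval x ∧
      f.eval (x + h) = f.eval x + (derivative f).eval x * h + c * h ^ 2 + d * h ^ 3 := by
  refine ⟨(hasseDeriv 2 f).eval x, ((taylor x f).divX.divX.divX).eval h, ?_, ?_⟩
  · have h2 := congrArg (fun g : Polynomial R => g.eval x)
      (congrFun (factorial_smul_hasseDeriv (R := R) (k := 2)) f)
    simpa [Nat.factorial, two_mul, two_smul] using h2
  · have key : ∀ g : Polynomial R, g.eval h = g.divX.eval h * h + g.coeff 0 := fun g => by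
      conv_lhs => rw [← divX_mul_X_add g]
      simp
    have h0 : f.eval (x + h) = (taylor x f).eval h := by rw [taylor_eval, add_comm]
    rw [h0, key (taylor x f), key (taylor x f).divX, key (taylor x f).divX.divX]
    simp only [coeff_divX, taylor_coeff, hasseDeriv_zero, zero_add, hasseDeriv_one,
      LinearMap.id_apply, Nat.reduceAdd]
    ring

/-- One Olver step from `y` towards a root `ξ` with `f'(y)` a unit stays in `ℤ_[p]`, and the new
error is divisible by the cube of the old one. -/
theorem PadicInt.exists_olver_step {p : ℕ} [Fact p.Prime] (f : Polynomial ℤ_[p]) (y ξ : ℤ_[p])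
    (hroot : f.eval ξ = 0) (hunit : IsUnit ((derivative f).eval y)) :
    ∃ z : ℤ_[p], (y : ℚ_[p]) - aeval (y : ℚ_[p]) f / aeval (y : ℚ_[p]) (derivative f)
        - (1 / 2) * ((aeval (y : ℚ_[p]) f) ^ 2 * aeval (y : ℚ_[p]) (derivative (derivative f))
            / (aeval (y : ℚ_[p]) (derivative f)) ^ 3) = z ∧
      (y - ξ) ^ 3 ∣ z - ξ := by
  have hcoe : ∀ g : Polynomial ℤ_[p], aeval (y : ℚ_[p]) g = (g.eval y : ℤ_[p]) := fun g =>
    aeval_algebraMap_apply_eq_algebraMap_eval y g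
  obtain ⟨c, d, hc, hd⟩ := f.exists_eval_add_eq_cubic y (ξ - y)
  rw [add_sub_cancel, hroot] at hd
  obtain ⟨u, hu⟩ := hunit.exists_right_inv
  rw [hcoe, hcoe, hcoe, ← hc]
  set F := f.eval y
  set D := (derivative f).eval y
  refine ⟨y - F * u - c * F ^ 2 * u ^ 3, ?_, ?_⟩
  · have huD : (D : ℚ_[p]) * (u : ℚ_[p]) = 1 := by
      rw [← PadicInt.coe_mul, hu, PadicInt.coe_one]
    have hD0 : (D : ℚ_[p]) ≠ 0 := left_ne_zero_of_mul_eq_one huD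
    have hu' : (u : ℚ_[p]) = (D : ℚ_[p])⁻¹ := eq_inv_of_mul_eq_one_right huD
    have h2 : ((2 : ℤ_[p]) : ℚ_[p]) = 2 := map_ofNat PadicInt.Coe.ringHom 2
    push_cast
    rw [hu', h2]
    field_simp
  · set h := ξ - y with hh
    have hy : y = ξ - h := by rw [hh]; ring
    have hF : F = -(D * h + c * h ^ 2 + d * h ^ 3) := by linear_combination -hd
    refine ⟨-(d * u - c * u ^ 3 * (2 * D * (c + d * h) + h * (c + d * h) ^ 2)), ?_⟩
    rw [hF, hy]
    linear_combination (h - c * h ^ 2 * u * (D * u + 1)) * hu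

/-- For an odd prime `p`, if `ξ ∈ ℤ_p` is the limit of the Olver sequence, a zero of
`f` with `ξ ≡ x₀ (mod p)`, then `|x_n − ξ|_p ≤ p^{-3^n}` for every `n`: the Olver
iterates converge to `ξ` at least at cubic rate. -/
theorem olver_cubic_rate_odd_prime (p : ℕ) [Fact p.Prime] (hp2 : p ≠ 2)
    (f : Polynomial ℤ_[p]) (hdeg : 1 ≤ f.natDegree) (x₀ : ℤ)
    (h0 : (p : ℤ_[p]) ∣ f.eval (x₀ : ℤ_[p]))
    (h1 : ¬ (p : ℤ_[p]) ∣ (derivative f).eval (x₀ : ℤ_[p]))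
    (ξ : ℤ_[p])
    (hlim : Filter.Tendsto (olverSeq f x₀) Filter.atTop (nhds (ξ : ℚ_[p])))
    (hroot : f.eval ξ = 0)
    (hcong : (p : ℤ_[p]) ∣ (ξ - (x₀ : ℤ_[p]))) :
    ∀ n : ℕ, ‖olverSeq f x₀ n - (ξ : ℚ_[p])‖ ≤ (p : ℝ) ^ (-(3 ^ n : ℤ)) := by
  have hmain : ∀ n : ℕ, ∃ y : ℤ_[p], olverSeq f x₀ n = y ∧ (p : ℤ_[p]) ^ 3 ^ n ∣ y - ξ := by
    intro n
    induction n with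
    | zero =>
      refine ⟨x₀, by simp [olverSeq], ?_⟩
      rw [pow_zero, pow_one, dvd_sub_comm]
      exact hcong
    | succ n ih =>
      obtain ⟨y, hy, hdvd⟩ := ih
      have hyx : (p : ℤ_[p]) ∣ y - x₀ := by
        rw [← sub_add_sub_cancel y ξ]
        exact dvd_add ((dvd_pow_self _ (by positivity)).trans hdvd) hcong
      have hunit : IsUnit ((derivative f).eval y) := by
        by_contra hnon
        have hpD : (p : ℤ_[p]) ∣ (derivative f).eval y :=
          PadicInt.norm_lt_one_iff_dvd _ |>.1 (PadicInt.mem_nonunits.1 hnon)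
        exact h1 ((dvd_sub_right hpD).1 (hyx.trans (sub_dvd_eval_sub _ _ _)))
      obtain ⟨z, hz, hzd⟩ := PadicInt.exists_olver_step f y ξ hroot hunit
      refine ⟨z, by rw [← hz, olverSeq, hy], ?_⟩
      rw [pow_succ 3 n, pow_mul]
      exact (pow_dvd_pow_of_dvd hdvd 3).trans hzd
  intro n
  obtain ⟨y, hy, hdvd⟩ := hmain n
  rw [hy, ← PadicInt.coe_sub, ← PadicInt.norm_def]
  have := (PadicInt.norm_le_pow_iff_mem_span_pow (y - ξ) (3 ^ n)).2
    (Ideal.mem_span_singleton.2 hdvd)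
  exact_mod_cast this
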